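/- arXiv:2406.19181 — 4 statements merged into one kernel-verified Lean document; each statement's English description precedes it below -/
import Mathlib

section
/- Let l ≥ 3, K > 0, and let q^1, …, q^l : ℝ → ℝ × ℝ be differentiable curves (cyclic indexing q^{l+1} = q^1, q^0 = q^l), and let c : ℝ → ℝ × ℝ be any curve (in particular, the centroid of the polygon with vertices q^1, …, q^l). If each vertex obeys the motion policy (q^i)'(t) = K·(c(t) − q^i(t)) for all t, then the shoelace area A(t) = (1/2)·Σ_{i=1}^{l} (q^i_x(t)·q^{i+1}_y(t) − q^{i+1}_x(t)·q^i_y(t)) satisfies A'(t) = −2K·A(t) for all t. -/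
/-- If every vertex of the (cyclically indexed) polygon moves toward the point `c t` according
to `(q^i)'(t) = K·(c(t) − q^i(t))` with `K > 0`, then the shoelace area
`A(t) = (1/2)·Σ_i (q^i_x·q^{i+1}_y − q^{i+1}_x·q^i_y)` satisfies `A'(t) = −2K·A(t)`. -/
theorem shoelace_area_deriv_of_move_to_point (l : ℕ) [NeZero l] (hl : 3 ≤ l)
    (K : ℝ) (hK : 0 < K) (q : ZMod l → ℝ → ℝ × ℝ) (c : ℝ → ℝ × ℝ)
    (hq : ∀ i t, HasDerivAt (q i) (K • (c t - q i t)) t) (t : ℝ) :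
    HasDerivAt
      (fun s => (1 / 2 : ℝ) * ∑ i : ZMod l,
        ((q i s).1 * (q (i + 1) s).2 - (q (i + 1) s).1 * (q i s).2))
      (-(2 * K) * ((1 / 2 : ℝ) * ∑ i : ZMod l,
        ((q i t).1 * (q (i + 1) t).2 - (q (i + 1) t).1 * (q i t).2))) t := by
  have hx (i : ZMod l) : HasDerivAt (fun s => (q i s).1) (K * ((c t).1 - (q i t).1)) t := by
    exact (ContinuousLinearMap.fst ℝ ℝ ℝ).hasFDerivAt.comp_hasDerivAt t (hq i t)
  have hy (i : ZMod l) : HasDerivAt (fun s => (q i s).2) (K * ((c t).2 - (q i t).2)) t := by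
    exact (ContinuousLinearMap.snd ℝ ℝ ℝ).hasFDerivAt.comp_hasDerivAt t (hq i t)
  have shift (f : ZMod l → ℝ) : ∑ i, f (i + 1) = ∑ i, f i :=
    Equiv.sum_comp (Equiv.addRight (1 : ZMod l)) f
  have hsum := HasDerivAt.fun_sum (u := Finset.univ) fun i _ =>
    ((hx i).mul (hy (i + 1))).sub ((hx (i + 1)).mul (hy i))
  refine (hsum.const_mul (1 / 2 : ℝ)).congr_deriv ?_
  have telescope : ∑ i : ZMod l, (K * (c t).1 * ((q (i + 1) t).2 - (q i t).2)
      + K * (c t).2 * ((q i t).1 - (q (i + 1) t).1)) = 0 := by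
    rw [Finset.sum_add_distrib, ← Finset.mul_sum, ← Finset.mul_sum, Finset.sum_sub_distrib,
      Finset.sum_sub_distrib, shift fun i => (q i t).2, shift fun i => (q i t).1]
    ring
  rw [mul_left_comm, ← add_zero (-(2 * K) * _), ← telescope]
  simp only [Finset.mul_sum, ← Finset.sum_add_distrib]
  refine Finset.sum_congr rfl fun i _ => ?_
  ring
end

section
/- (Theorem 1, exponential form) Let l ≥ 3, K > 0, and let q^1, …, q^l : ℝ → ℝ × ℝ be differentiable curves (cyclic indexing q^{l+1} = q^1, q^0 = q^l), and let c : ℝ → ℝ × ℝ be any curve. If every vertex obeys (q^i)'(t) = K·(c(t) − q^i(t)) for all t ≥ 0, then the shoelace area satisfies A(t) = A(0)·exp(−2K·t) for all t ≥ 0. -/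
/-- The shoelace (signed) area of the polygon with vertices `q i`, cyclically indexed. -/
noncomputable def shoelaceArea (l : ℕ) [NeZero l] (q : ZMod l → ℝ × ℝ) : ℝ :=
  (1 / 2 : ℝ) * ∑ i : ZMod l, ((q i).1 * (q (i + 1)).2 - (q (i + 1)).1 * (q i).2)

/-- Shrinking every vertex towards a common point changes the shoelace area at rate `-2K`
times itself: the contribution of the common point telescopes. -/
theorem hasDerivAt_shoelaceArea (l : ℕ) [NeZero l] (K : ℝ) (q : ZMod l → ℝ → ℝ × ℝ) (c : ℝ × ℝ)
    (t : ℝ) (hq : ∀ i, HasDerivAt (q i) (K • (c - q i t)) t) :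
    HasDerivAt (fun s => shoelaceArea l (fun i => q i s))
      (-(2 * K) * shoelaceArea l (fun i => q i t)) t := by
  have hx (i : ZMod l) : HasDerivAt (fun s => (q i s).1) (K * (c.1 - (q i t).1)) t :=
    (hq i).fst
  have hy (i : ZMod l) : HasDerivAt (fun s => (q i s).2) (K * (c.2 - (q i t).2)) t :=
    (hq i).snd
  have hshift (f : ZMod l → ℝ) : ∑ i, f (i + 1) = ∑ i, f i :=
    Equiv.sum_comp (Equiv.addRight (1 : ZMod l)) f
  have hsum := (HasDerivAt.fun_sum (u := Finset.univ) fun i (_ : i ∈ Finset.univ) =>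
    ((hx i).mul (hy (i + 1))).sub ((hx (i + 1)).mul (hy i))).const_mul (1 / 2 : ℝ)
  refine hsum.congr_deriv ?_
  have hterm (i : ZMod l) :
      K * (c.1 - (q i t).1) * (q (i + 1) t).2 + (q i t).1 * (K * (c.2 - (q (i + 1) t).2)) -
        (K * (c.1 - (q (i + 1) t).1) * (q i t).2 + (q (i + 1) t).1 * (K * (c.2 - (q i t).2))) =
      -(2 * K) * ((q i t).1 * (q (i + 1) t).2 - (q (i + 1) t).1 * (q i t).2) +
        (K * c.1 * ((q (i + 1) t).2 - (q i t).2) - K * c.2 * ((q (i + 1) t).1 - (q i t).1)) := by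
    ring
  simp only [hterm, shoelaceArea]
  rw [Finset.sum_add_distrib, Finset.sum_sub_distrib, ← Finset.mul_sum, ← Finset.mul_sum,
    ← Finset.mul_sum, Finset.sum_sub_distrib (fun i => (q (i + 1) t).2),
    Finset.sum_sub_distrib (fun i => (q (i + 1) t).1), hshift fun i => (q i t).2,
    hshift fun i => (q i t).1]
  ring

/-- A solution of `f' = a f` on `[0, ∞)` is an exponential there. -/
theorem eq_mul_exp_of_hasDerivAt {f : ℝ → ℝ} {a : ℝ}
    (hf : ∀ t, 0 ≤ t → HasDerivAt f (a * f t) t) {t : ℝ} (ht : 0 ≤ t) :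
    f t = f 0 * Real.exp (a * t) := by
  have hderiv (s : ℝ) (hs : 0 ≤ s) : HasDerivAt (fun s => f s * Real.exp (-(a * s))) 0 s := by
    have hexp : HasDerivAt (fun s => Real.exp (-(a * s))) (Real.exp (-(a * s)) * -(a * 1)) s :=
      ((hasDerivAt_id s).const_mul a).neg.exp
    exact ((hf s hs).mul hexp).congr_deriv (by ring)
  have hconst := constant_of_has_deriv_right_zero
    (fun s hs => (hderiv s hs.1).continuousAt.continuousWithinAt)
    (fun s hs => (hderiv s hs.1).hasDerivWithinAt) t ⟨ht, le_rfl⟩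
  simp only [mul_zero, neg_zero, Real.exp_zero, mul_one] at hconst
  rw [← hconst, mul_assoc, ← Real.exp_add, neg_add_cancel, Real.exp_zero, mul_one]

/-- (Theorem 1, exponential form) If every vertex of the polygon obeys the motion policy
`(q^i)'(t) = K·(c(t) − q^i(t))` for all `t ≥ 0` (with `K > 0`), then the shoelace area
satisfies `A(t) = A(0)·exp(−2K·t)` for all `t ≥ 0`. -/
theorem shoelace_area_exp_decay (l : ℕ) [NeZero l] (hl : 3 ≤ l)
    (K : ℝ) (hK : 0 < K) (q : ZMod l → ℝ → ℝ × ℝ) (c : ℝ → ℝ × ℝ)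
    (hdiff : ∀ i, Differentiable ℝ (q i))
    (hq : ∀ i t, 0 ≤ t → HasDerivAt (q i) (K • (c t - q i t)) t) :
    ∀ t, 0 ≤ t →
      shoelaceArea l (fun i => q i t) = shoelaceArea l (fun i => q i 0) * Real.exp (-(2 * K) * t) := by
  intro t ht
  exact eq_mul_exp_of_hasDerivAt (f := fun s => shoelaceArea l fun i => q i s)
    (fun s hs => hasDerivAt_shoelaceArea l K q (c s) s fun i => hq i s hs) ht
end

section
/- Let e ∈ ℝ² and let p_1, …, p_N ∈ ℝ² (N ≥ 1) be points all distinct from e. Define the Voronoi cell of e as S = {x ∈ ℝ² : dist(x, e) ≤ dist(x, p_i) for all i}. Then the infimum distance from e to the complement of S equals (1/2)·min_{1 ≤ i ≤ N} dist(e, p_i). In particular, the distance from the evader to its nearest pursuer is twice the distance from the evader to the boundary of its proximity region. -/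
/-- A point strictly closer to `q` than to `e` is farther from `e` than half of `dist e q`. -/
lemma half_dist_lt_of_dist_lt {X : Type*} [PseudoMetricSpace X] {e q x : X}
    (h : dist x q < dist x e) : (1 / 2 : ℝ) * dist e q < dist e x := by
  have := dist_triangle e x q
  rw [dist_comm x e] at h
  linarith

/-- A point past the midpoint of the segment from `e` to `q` is strictly closer to `q`. -/
lemma dist_lineMap_right_lt_dist_lineMap_left {E : Type*} [NormedAddCommGroup E]
    [NormedSpace ℝ E] {e q : E} (hq : q ≠ e) {t : ℝ} (ht : 1 / 2 < t) :
    dist (AffineMap.lineMap e q t) q < dist (AffineMap.lineMap e q t) e := by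
  have hd : 0 < dist e q := dist_pos.mpr hq.symm
  rw [dist_lineMap_right, dist_lineMap_left, Real.norm_eq_abs, Real.norm_eq_abs]
  refine mul_lt_mul_of_pos_right ?_ hd
  rw [abs_of_pos (by linarith : 0 < t), abs_lt]
  constructor <;> linarith

/-- If `s` contains every point strictly closer to `q` than to `e`, then the distance from `e`
to `s` is at most half of `dist e q`. -/
lemma infDist_le_half_dist {E : Type*} [NormedAddCommGroup E] [NormedSpace ℝ E] {e q : E}
    (hq : q ≠ e) {s : Set E} (hs : {x | dist x q < dist x e} ⊆ s) :
    Metric.infDist e s ≤ (1 / 2 : ℝ) * dist e q := by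
  have hd : 0 < dist e q := dist_pos.mpr hq.symm
  rw [← div_le_iff₀ hd]
  refine le_of_forall_gt_imp_ge_of_dense fun t ht => ?_
  rw [div_le_iff₀ hd]
  refine (Metric.infDist_le_dist_of_mem
    (hs (dist_lineMap_right_lt_dist_lineMap_left hq ht))).trans_eq ?_
  rw [dist_left_lineMap, Real.norm_of_nonneg (by linarith)]


/-- The infimum distance from the evader `e` to the complement of its Voronoi cell
(w.r.t. pursuers `p 1, …, p N`, all distinct from `e`) equals half the minimum distance
from `e` to a pursuer. -/
theorem infDist_compl_voronoiCell (N : ℕ) (hN : 1 ≤ N)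
    (e : EuclideanSpace ℝ (Fin 2)) (p : Fin N → EuclideanSpace ℝ (Fin 2))
    (hp : ∀ i, p i ≠ e) :
    Metric.infDist e ({x : EuclideanSpace ℝ (Fin 2) | ∀ i, dist x e ≤ dist x (p i)}ᶜ)
      = (1 / 2 : ℝ) *
        Finset.univ.inf' (Finset.univ_nonempty_iff.mpr (Fin.pos_iff_nonempty.mp hN))
          (fun i => dist e (p i)) := by
  have : Nonempty (Fin N) := Fin.pos_iff_nonempty.mp hN
  have hsub (i : Fin N) : {x | dist x (p i) < dist x e} ⊆
      {x : EuclideanSpace ℝ (Fin 2) | ∀ i, dist x e ≤ dist x (p i)}ᶜ :=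
    fun x hx hmem => (hmem i).not_gt hx
  apply le_antisymm
  · obtain ⟨i, -, hi⟩ := Finset.exists_mem_eq_inf' Finset.univ_nonempty fun i => dist e (p i)
    rw [hi]
    exact infDist_le_half_dist (hp i) (hsub i)
  · obtain ⟨i⟩ := this
    have hne := (show Set.Nonempty {x | dist x (p i) < dist x e} from
      ⟨p i, by simpa using hp i⟩).mono (hsub i)
    refine (Metric.le_infDist hne).mpr fun x hx => ?_
    simp only [Set.mem_compl_iff, Set.mem_ofPred_eq, not_forall, not_le] at hx
    obtain ⟨j, hj⟩ := hx
    refine le_trans ?_ (half_dist_lt_of_dist_lt hj).le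
    gcongr
    exact Finset.inf'_le _ (Finset.mem_univ j)
end

section
/- (Lemma 1) Let m ≥ 3. Let P₁ ⊆ ℝ² be a regular m-gon (the convex hull of the m points c₀ + R·(cos(2πk/m + φ), sin(2πk/m + φ)), k = 0, …, m−1, for some center c₀, circumradius R > 0, and phase φ), and let P₂ ⊆ ℝ² be the convex hull of m points, having the same (positive) Lebesgue area as P₁. If P₂ is not the image of P₁ under any isometry of the plane, then the Chebyshev radius of P₂ is strictly less than the Chebyshev radius of P₁. -/
open Metric MeasureTheory

/-- The regular `m`-gon in the Euclidean plane with center `c₀`, circumradius `R`, and phase `φ`: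
the convex hull of the points `c₀ + R·(cos(2πk/m + φ), sin(2πk/m + φ))`, `k = 0, …, m−1`. -/
noncomputable def regularPolygon (m : ℕ) (c₀ : EuclideanSpace ℝ (Fin 2)) (R φ : ℝ) :
    Set (EuclideanSpace ℝ (Fin 2)) :=
  convexHull ℝ (Set.range fun k : Fin m =>
    c₀ + R • (WithLp.equiv 2 (Fin 2 → ℝ)).symm
      ![Real.cos (2 * Real.pi * k.1 / m + φ), Real.sin (2 * Real.pi * k.1 / m + φ)])

/-- The Chebyshev radius (inradius) of a set `S ⊆ ℝ²`: the radius of the largest closed ball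
contained in `S`. -/
noncomputable def chebyshevRadius (S : Set (EuclideanSpace ℝ (Fin 2))) : ℝ :=
  sSup {r : ℝ | 0 ≤ r ∧ ∃ c, closedBall c r ⊆ S}

open Real Set

/-- The unit vector of the Euclidean plane at angle `θ`. -/
noncomputable def unitVec (θ : ℝ) : EuclideanSpace ℝ (Fin 2) := !₂[cos θ, sin θ]

/-- The part of the disc of radius `R` about the origin lying beyond the line at signed distance
`r` from the origin with normal direction `θ`. -/
def discCap (r R θ : ℝ) : Set (EuclideanSpace ℝ (Fin 2)) :=
  {x | x ∈ closedBall 0 R ∧ r < inner ℝ (unitVec θ) x}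

section UnitVec

theorem inner_eq_coord (x y : EuclideanSpace ℝ (Fin 2)) :
    inner ℝ x y = x 0 * y 0 + x 1 * y 1 := by
  simp [PiLp.inner_apply, Fin.sum_univ_two]; ring

@[simp] theorem unitVec_zero (θ : ℝ) : unitVec θ 0 = cos θ := rfl

@[simp] theorem unitVec_one (θ : ℝ) : unitVec θ 1 = sin θ := rfl

theorem inner_unitVec (θ η : ℝ) : inner ℝ (unitVec θ) (unitVec η) = cos (θ - η) := by
  rw [inner_eq_coord, cos_sub]; rfl

@[simp] theorem norm_unitVec (θ : ℝ) : ‖unitVec θ‖ = 1 := by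
  have h := real_inner_self_eq_norm_sq (unitVec θ)
  rw [inner_unitVec, sub_self, cos_zero] at h
  nlinarith [norm_nonneg (unitVec θ)]

theorem unitVec_add_int_mul_two_pi (θ : ℝ) (n : ℤ) :
    unitVec (θ + n * (2 * π)) = unitVec θ := by
  simp [unitVec, cos_add_int_mul_two_pi, sin_add_int_mul_two_pi]

theorem exists_eq_norm_smul_unitVec (x : EuclideanSpace ℝ (Fin 2)) :
    ∃ θ, x = ‖x‖ • unitVec θ := by
  have hn : ‖x‖ = ‖(⟨x 0, x 1⟩ : ℂ)‖ := by
    rw [Complex.norm_eq_sqrt_sq_add_sq, EuclideanSpace.norm_eq]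
    simp [Fin.sum_univ_two]
  refine ⟨Complex.arg ⟨x 0, x 1⟩, ?_⟩
  ext i
  fin_cases i
  · simp [hn]
  · simp [hn]

theorem regularPolygon_eq (m : ℕ) (c₀ : EuclideanSpace ℝ (Fin 2)) (R φ : ℝ) :
    regularPolygon m c₀ R φ =
      convexHull ℝ (range fun k : Fin m => c₀ + R • unitVec (2 * π * k.1 / m + φ)) := rfl

end UnitVec

section Angles

theorem exists_int_abs_sub_lt_of_cos_lt {x δ : ℝ} (hδ : 0 ≤ δ) (hδπ : δ ≤ π)
    (h : cos δ < cos x) : ∃ q : ℤ, |x - q * (2 * π)| < δ := by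
  refine ⟨round (x / (2 * π)), ?_⟩
  set q := round (x / (2 * π))
  have h1 : |x / (2 * π) - q| ≤ 1 / 2 := abs_sub_round _
  have hp := pi_pos
  have h2 : |x - q * (2 * π)| ≤ π := by
    have : x - q * (2 * π) = (x / (2 * π) - q) * (2 * π) := by field_simp
    rw [this, abs_mul, abs_of_pos (by positivity : 0 < 2 * π)]
    nlinarith
  by_contra! h3
  have h4 := cos_le_cos_of_nonneg_of_le_pi hδ h2 h3
  rw [cos_abs, cos_sub_int_mul_two_pi] at h4
  linarith

theorem cos_odd_mul_pi_div_le (m : ℕ) (hm : 3 ≤ m) (n : ℤ) :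
    cos ((2 * n + 1) * π / m) ≤ cos (π / m) := by
  have hm0 : (0 : ℝ) < m := by positivity
  have hp := pi_pos
  by_contra! h
  obtain ⟨q, hq⟩ := exists_int_abs_sub_lt_of_cos_lt (by positivity)
    (div_le_self hp.le (by exact_mod_cast (by omega : 1 ≤ m))) h
  have h1 : (2 * n + 1) * π / m - q * (2 * π) = ((2 * n + 1 - 2 * q * m : ℤ) : ℝ) * (π / m) := by
    push_cast; field_simp
  rw [h1, abs_mul, abs_of_pos (by positivity : 0 < π / m)] at hq
  have h2 : |((2 * n + 1 - 2 * q * m : ℤ) : ℝ)| < 1 := by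
    by_contra! h3
    nlinarith [div_pos hp hm0]
  rw [← Int.cast_abs] at h2
  have h3 : |2 * n + 1 - 2 * q * m| < 1 := by exact_mod_cast h2
  rw [Int.abs_lt_one_iff] at h3
  have : 2 * (q * m - n) = 1 := by linarith
  omega

/-- If `m` reals are pairwise at distance at least `1` modulo `m`, then they are congruent to each
other modulo `1`. -/
theorem exists_int_of_one_le_abs_sub {m : ℕ} (hm : 2 ≤ m) (β : Fin m → ℝ) (i₀ : Fin m)
    (h0 : β i₀ = 0) (h : ∀ i j, i ≠ j → ∀ n : ℤ, 1 ≤ |β i - β j + m * n|) (i : Fin m) :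
    ∃ n : ℤ, β i = n := by
  have : NeZero m := ⟨by omega⟩
  have : Fact (1 < m) := ⟨by omega⟩
  let g : Fin m → ZMod m := fun i => (⌊β i⌋ : ZMod m)
  have key : ∀ i j (a : ℤ), g i = g j + a →
      ∃ n : ℤ, β i - β j + m * n = a + (Int.fract (β i) - Int.fract (β j)) := by
    intro i j a hij
    have h1 : ((⌊β i⌋ : ℤ) : ZMod m) = ((⌊β j⌋ + a : ℤ) : ZMod m) := by
      push_cast; exact hij
    rw [ZMod.intCast_eq_intCast_iff_dvd_sub] at h1
    obtain ⟨n, hn⟩ := h1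
    refine ⟨n, ?_⟩
    have hn' : (⌊β j⌋ : ℝ) + a - ⌊β i⌋ = m * n := by exact_mod_cast hn
    rw [Int.fract, Int.fract]; linarith
  have ginj : Function.Injective g := by
    intro i j hij
    by_contra hne
    obtain ⟨n, hn⟩ := key i j 0 (by simpa using hij)
    have h1 := h i j hne n
    rw [hn, le_abs] at h1
    have := Int.fract_nonneg (β i)
    have := Int.fract_nonneg (β j)
    have := Int.fract_lt_one (β i)
    have := Int.fract_lt_one (β j)
    push_cast at h1
    rcases h1 with h1 | h1 <;> linarith
  have gbij : Function.Bijective g :=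
    (Fintype.bijective_iff_injective_and_card g).2 ⟨ginj, by simp [ZMod.card]⟩
  let σ := (Equiv.ofBijective g gbij).symm
  have gσ : ∀ k, g (σ k) = k := fun k => (Equiv.ofBijective g gbij).apply_symm_apply k
  let f : ZMod m → ℝ := fun k => Int.fract (β (σ k))
  have fstep : ∀ k, f k ≤ f (k + 1) := by
    intro k
    have hne : σ (k + 1) ≠ σ k := by
      intro he
      have := σ.injective he
      simp at this
    obtain ⟨n, hn⟩ := key (σ (k + 1)) (σ k) 1 (by simp [gσ])
    have h1 := h _ _ hne n
    rw [hn, le_abs] at h1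
    have := Int.fract_nonneg (β (σ (k + 1)))
    have := Int.fract_lt_one (β (σ k))
    push_cast at h1
    change Int.fract (β (σ k)) ≤ Int.fract (β (σ (k + 1)))
    rcases h1 with h1 | h1 <;> linarith
  have fadd : ∀ (n : ℕ) k, f k ≤ f (k + n) := by
    intro n
    induction n with
    | zero => intro k; simp
    | succ n ih =>
      intro k
      have := fstep (k + n)
      push_cast
      rw [← add_assoc]
      exact (ih k).trans this
  have h1 := fadd (g i₀ - g i).val (g i)
  rw [ZMod.natCast_val, ZMod.cast_id, add_sub_cancel] at h1
  have h2 : ∀ j, f (g j) = Int.fract (β j) := fun j => by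
    change Int.fract (β (σ (g j))) = _
    rw [ginj (gσ (g j))]
  rw [h2, h2, h0, Int.fract_zero] at h1
  refine ⟨⌊β i⌋, ?_⟩
  have := Int.fract_nonneg (β i)
  have := Int.self_sub_floor (β i)
  linarith

end Angles

section Polar

theorem mem_convexHull_range_of_forall_polar {ι : Type*} [Finite ι]
    {v : ι → EuclideanSpace ℝ (Fin 2)} (h0 : 0 ∈ convexHull ℝ (range v))
    {x : EuclideanSpace ℝ (Fin 2)}
    (h : ∀ u : EuclideanSpace ℝ (Fin 2), (∀ k, inner ℝ u (v k) ≤ 1) → inner ℝ u x ≤ 1) :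
    x ∈ convexHull ℝ (range v) := by
  by_contra hx
  obtain ⟨f, s, hf, hs⟩ := geometric_hahn_banach_closed_point (convex_convexHull ℝ (range v))
    ((finite_range v).isCompact_convexHull ℝ).isClosed hx
  have hs0 : 0 < s := by simpa using hf 0 h0
  let w := (InnerProductSpace.toDual ℝ (EuclideanSpace ℝ (Fin 2))).symm f
  have hw : ∀ y, inner ℝ w y = f y := fun y => InnerProductSpace.toDual_symm_apply
  have := h (s⁻¹ • w) fun k => by
    rw [real_inner_smul_left, hw, inv_mul_le_iff₀ hs0, mul_one]
    exact (hf _ (subset_convexHull ℝ _ (mem_range_self k))).le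
  rw [real_inner_smul_left, hw, inv_mul_le_iff₀ hs0, mul_one] at this
  linarith

theorem inner_le_of_mem_convexHull {s : Set (EuclideanSpace ℝ (Fin 2))}
    {u x : EuclideanSpace ℝ (Fin 2)} {b : ℝ} (h : ∀ y ∈ s, inner ℝ u y ≤ b)
    (hx : x ∈ convexHull ℝ s) : inner ℝ u x ≤ b :=
  convexHull_min (t := {y | inner ℝ u y ≤ b}) h
    (convex_halfSpace_le (innerₛₗ ℝ u).isLinear b) hx

theorem mul_norm_le_one_of_polar {ι : Type*} {v : ι → EuclideanSpace ℝ (Fin 2)} {r : ℝ}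
    (hr : 0 ≤ r) (hball : closedBall 0 r ⊆ convexHull ℝ (range v))
    {u : EuclideanSpace ℝ (Fin 2)} (hu : ∀ k, inner ℝ u (v k) ≤ 1) : ‖u‖ * r ≤ 1 := by
  obtain ⟨θ, hθ⟩ := exists_eq_norm_smul_unitVec u
  have hx : r • unitVec θ ∈ convexHull ℝ (range v) :=
    hball (by simp [norm_smul, abs_of_nonneg hr])
  have := inner_le_of_mem_convexHull (u := u) (b := 1) (by rintro _ ⟨k, rfl⟩; exact hu k) hx
  rw [hθ, real_inner_smul_left, real_inner_smul_right, inner_unitVec] at this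
  simpa using this

/-- At an extreme point of the polar of finitely many points of the plane, two linearly independent
constraints are tight. -/
theorem exists_tight_pair_of_mem_extremePoints {ι : Type*} [Finite ι]
    {v : ι → EuclideanSpace ℝ (Fin 2)} {u : EuclideanSpace ℝ (Fin 2)}
    (hu : u ∈ extremePoints ℝ {w | ∀ k, inner ℝ w (v k) ≤ 1}) :
    ∃ i j, inner ℝ u (v i) = 1 ∧ inner ℝ u (v j) = 1 ∧
      0 < v i 0 * v j 1 - v i 1 * v j 0 := by
  by_contra! hcon
  have hcross : ∀ i j, inner ℝ u (v i) = 1 → inner ℝ u (v j) = 1 →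
      v i 0 * v j 1 - v i 1 * v j 0 = 0 := by
    intro i j hi hj
    have h1 := hcon i j hi hj
    have h2 := hcon j i hj hi
    linarith
  obtain ⟨w, hw0, hw⟩ : ∃ w : EuclideanSpace ℝ (Fin 2), w ≠ 0 ∧
      ∀ k, inner ℝ u (v k) = 1 → inner ℝ w (v k) = 0 := by
    by_cases hk : ∃ k, inner ℝ u (v k) = 1
    · obtain ⟨k, hk⟩ := hk
      refine ⟨!₂[-v k 1, v k 0], ?_, fun j hj => ?_⟩
      · intro h
        have h1 := congrArg (fun y : EuclideanSpace ℝ (Fin 2) => y 0) h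
        have h2 := congrArg (fun y : EuclideanSpace ℝ (Fin 2) => y 1) h
        simp at h1 h2
        rw [inner_eq_coord, h1, h2] at hk
        simp at hk
      · have := hcross k j hk hj
        rw [inner_eq_coord]
        simp
        linarith
    · exact ⟨unitVec 0, fun h => by simpa [h] using norm_unitVec 0, fun k h => (hk ⟨k, h⟩).elim⟩
  have hev : ∀ᶠ t : ℝ in nhdsWithin 0 (Ioi 0), ∀ k,
      inner ℝ (u + t • w) (v k) ≤ 1 ∧ inner ℝ (u - t • w) (v k) ≤ 1 := by
    refine Filter.Eventually.filter_mono nhdsWithin_le_nhds (Filter.eventually_all.2 fun k => ?_)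
    rcases (hu.1 k).eq_or_lt with hk | hk
    · refine Filter.Eventually.of_forall fun t => ?_
      simp [inner_add_left, inner_sub_left, real_inner_smul_left, hw k hk, hk]
    · have c1 : ContinuousAt (fun t : ℝ => inner ℝ (u + t • w) (v k)) 0 := by fun_prop
      have c2 : ContinuousAt (fun t : ℝ => inner ℝ (u - t • w) (v k)) 0 := by fun_prop
      filter_upwards [c1.eventually_lt_const (by simpa using hk),
        c2.eventually_lt_const (by simpa using hk)] with t h1 h2 using ⟨h1.le, h2.le⟩
  obtain ⟨t, ht, ht0⟩ := (hev.and self_mem_nhdsWithin).exists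
  have ht0 : 0 < t := ht0
  have heq := hu.2 (fun k => (ht k).1) (fun k => (ht k).2)
    ⟨1 / 2, 1 / 2, by norm_num, by norm_num, by norm_num, by module⟩
  simp [hw0, ht0.ne'] at heq

/-- A convex hull of `m` points of the plane containing a disc about the origin is cut out by `m`
half-planes. -/
theorem exists_normals {m : ℕ} {v : Fin m → EuclideanSpace ℝ (Fin 2)} {r : ℝ} (hr : 0 < r)
    (hball : closedBall 0 r ⊆ convexHull ℝ (range v)) :
    ∃ α : Fin m → ℝ, ∀ x : EuclideanSpace ℝ (Fin 2),
      (∀ i, inner ℝ (unitVec (α i)) x ≤ r) → x ∈ convexHull ℝ (range v) := by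
  classical
  set K : Set (EuclideanSpace ℝ (Fin 2)) := {w | ∀ k, inner ℝ w (v k) ≤ 1} with hK
  have hKeq : K = ⋂ k, {w | inner ℝ (v k) w ≤ 1} := by
    ext w; simp [hK, real_inner_comm]
  have hKconv : Convex ℝ K := by
    rw [hKeq]
    exact convex_iInter fun k => convex_halfSpace_le (innerₛₗ ℝ (v k)).isLinear 1
  have hKcomp : IsCompact K := by
    refine isCompact_of_isClosed_isBounded ?_ ?_
    · rw [hKeq]
      exact isClosed_iInter fun k => isClosed_le (by fun_prop) continuous_const
    · refine (isBounded_closedBall (x := (0 : EuclideanSpace ℝ (Fin 2))) (r := 1 / r)).subset ?_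
      intro u hu
      rw [mem_closedBall_zero_iff, le_div_iff₀ hr]
      exact mul_norm_le_one_of_polar hr.le hball hu
  let T : Fin m → EuclideanSpace ℝ (Fin 2) → Prop := fun i u => u ∈ K ∧ inner ℝ u (v i) = 1 ∧
    ∃ j, inner ℝ u (v j) = 1 ∧ 0 < v i 0 * v j 1 - v i 1 * v j 0
  have huniq : ∀ i u u', T i u → T i u' → u = u' := by
    rintro i u u' ⟨hu, hui, j, huj, hj⟩ ⟨hu', hui', j', huj', hj'⟩
    have h1 := hu' j
    have h2 := hu j'
    rw [inner_eq_coord] at hui huj hui' huj' h1 h2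
    set a := v i 0
    set b := v i 1
    have hab : 0 < a ^ 2 + b ^ 2 := by
      rcases eq_or_ne a 0 with ha | ha
      · rcases eq_or_ne b 0 with hb | hb
        · simp [ha, hb] at hj
        · positivity
      · positivity
    obtain ⟨t, ht0, ht1⟩ : ∃ t, u 0 - u' 0 = -t * b ∧ u 1 - u' 1 = t * a := by
      refine ⟨((u 1 - u' 1) * a - (u 0 - u' 0) * b) / (a ^ 2 + b ^ 2), ?_, ?_⟩
      · field_simp
        linear_combination (hui - hui') * a
      · field_simp
        linear_combination (hui - hui') * b
    have e1 : 0 ≤ t * (a * v j 1 - b * v j 0) := by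
      linear_combination h1 - huj + ht0 * v j 0 + ht1 * v j 1
    have e2 : 0 ≤ -t * (a * v j' 1 - b * v j' 0) := by
      linear_combination h2 - huj' - ht0 * v j' 0 - ht1 * v j' 1
    have e3 : 0 ≤ t := nonneg_of_mul_nonneg_left e1 hj
    have e4 : 0 ≤ -t := nonneg_of_mul_nonneg_left e2 hj'
    have e5 : t = 0 := by linarith
    ext k
    fin_cases k
    · simp [e5] at ht0 ⊢; linarith
    · simp [e5] at ht1 ⊢; linarith
  have hα : ∀ i, ∃ θ : ℝ, ∀ u, T i u → u = ‖u‖ • unitVec θ := by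
    intro i
    by_cases h : ∃ u, T i u
    · obtain ⟨u, hu⟩ := h
      obtain ⟨θ, hθ⟩ := exists_eq_norm_smul_unitVec u
      refine ⟨θ, fun u' hu' => ?_⟩
      rwa [huniq i u' u hu' hu]
    · exact ⟨0, fun u hu => (h ⟨u, hu⟩).elim⟩
  choose α hα using hα
  refine ⟨α, fun x hx => ?_⟩
  refine mem_convexHull_range_of_forall_polar (hball (by simp [hr.le])) fun u hu => ?_
  have hext : extremePoints ℝ K ⊆ {w | inner ℝ x w ≤ 1} := by
    intro w hw
    obtain ⟨i, j, hi, hj, hij⟩ := exists_tight_pair_of_mem_extremePoints hw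
    have h1 := hα i w ⟨hw.1, hi, j, hj, hij⟩
    have h2 := mul_norm_le_one_of_polar hr.le hball hw.1
    change inner ℝ x w ≤ 1
    rw [h1, real_inner_smul_right, real_inner_comm]
    exact (mul_le_mul_of_nonneg_left (hx i) (norm_nonneg w)).trans h2
  have huK : u ∈ K := hu
  rw [← closure_convexHull_extremePoints hKcomp hKconv] at huK
  have := closure_minimal (convexHull_min hext
    (convex_halfSpace_le (innerₛₗ ℝ x).isLinear 1))
    (isClosed_le (by fun_prop) continuous_const) huK
  rw [real_inner_comm]
  exact this

end Polar

section Caps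

theorem measurableSet_discCap (r R θ : ℝ) : MeasurableSet (discCap r R θ) :=
  measurableSet_closedBall.inter
    (isOpen_lt (f := fun _ => r) (g := fun x => inner ℝ (unitVec θ) x) continuous_const
      (by fun_prop)).measurableSet

theorem discCap_subset_closedBall (r R θ : ℝ) : discCap r R θ ⊆ closedBall 0 R :=
  fun _ hx => hx.1

theorem volume_discCap (r R θ : ℝ) : volume (discCap r R θ) = volume (discCap r R 0) := by
  let ρ := (ℝ ∙ (unitVec 0 - unitVec θ))ᗮ.reflection
  have hρ : ρ (unitVec 0) = unitVec θ :=
    Submodule.reflection_sub (by simp)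
  have : ρ ⁻¹' (discCap r R θ) = discCap r R 0 := by
    ext x
    simp [discCap, ← hρ]
  rw [← this]
  exact (ρ.measurePreserving.measure_preimage (measurableSet_discCap r R θ).nullMeasurableSet).symm

theorem volume_discCap_ne_top (r R θ : ℝ) : volume (discCap r R θ) ≠ ⊤ :=
  measure_ne_top_of_subset (discCap_subset_closedBall r R θ) measure_closedBall_lt_top.ne

/-- If the measures of finitely many sets of finite measure add up to at most the measure of their
union, then the sets are pairwise almost everywhere disjoint. -/
theorem measure_inter_eq_zero_of_sum_le_measure_iUnion {ι α : Type*} [Fintype ι]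
    [MeasurableSpace α] {μ : Measure α} {s : ι → Set α} (hs : ∀ i, MeasurableSet (s i))
    (hfin : ∀ i, μ (s i) ≠ ⊤) (h : ∑ i, μ (s i) ≤ μ (⋃ i, s i)) {i j : ι} (hij : i ≠ j) :
    μ (s i ∩ s j) = 0 := by
  classical
  have hsub : (⋃ i, s i) ⊆ (⋃ k ∈ Finset.univ.erase j, s k) ∪ (s j \ s i) := by
    intro x hx
    obtain ⟨k, hk⟩ := mem_iUnion.1 hx
    by_cases hxi : x ∈ s i
    · exact Or.inl (mem_biUnion (x := i) (by simpa using hij) hxi)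
    · rcases eq_or_ne k j with rfl | hkj
      · exact Or.inr ⟨hk, hxi⟩
      · exact Or.inl (mem_biUnion (x := k) (by simpa using hkj) hk)
  have h1 : ∑ k, μ (s k) ≤ ∑ k ∈ Finset.univ.erase j, μ (s k) + μ (s j \ s i) :=
    h.trans <| (measure_mono hsub).trans <| (measure_union_le _ _).trans <|
      add_le_add_left (measure_biUnion_finset_le _ _) _
  rw [← Finset.sum_erase_add _ _ (Finset.mem_univ j)] at h1
  have h2 : μ (s j) ≤ μ (s j \ s i) :=
    (ENNReal.add_le_add_iff_left (ENNReal.sum_ne_top.2 fun k _ => hfin k)).1 h1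
  rw [← measure_inter_add_sdiff (s j) (hs i)] at h2
  have h3 : μ (s j \ s i) ≠ ⊤ := measure_ne_top_of_subset sdiff_subset (hfin j)
  rw [inter_comm]
  have h4 : μ (s j ∩ s i) + μ (s j \ s i) ≤ 0 + μ (s j \ s i) := by simpa using h2
  exact le_antisymm ((ENNReal.add_le_add_iff_right h3).1 h4) zero_le

theorem two_mul_le_abs_sub_of_volume_inter_discCap {R δ : ℝ} (hR : 0 < R) (hδ : δ ≤ π)
    {α β : ℝ} (h : volume (discCap (R * cos δ) R α ∩ discCap (R * cos δ) R β) = 0) :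
    2 * δ ≤ |α - β| := by
  by_contra! hlt
  have hcos : cos δ < cos ((α - β) / 2) := by
    rw [← cos_abs ((α - β) / 2)]
    apply cos_lt_cos_of_nonneg_of_le_pi (abs_nonneg _) hδ
    rw [abs_div, abs_two]
    linarith
  let U : Set (EuclideanSpace ℝ (Fin 2)) :=
    {x | ‖x‖ < R} ∩ ({x | R * cos δ < inner ℝ (unitVec α) x} ∩
      {x | R * cos δ < inner ℝ (unitVec β) x})
  have hU : IsOpen U := (isOpen_lt (by fun_prop) continuous_const).inter
    ((isOpen_lt continuous_const (by fun_prop)).inter (isOpen_lt continuous_const (by fun_prop)))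
  have hUsub : U ⊆ discCap (R * cos δ) R α ∩ discCap (R * cos δ) R β := by
    rintro x ⟨h1, h2, h3⟩
    have h1 : x ∈ closedBall (0 : EuclideanSpace ℝ (Fin 2)) R := by
      simpa using (show ‖x‖ < R from h1).le
    exact ⟨⟨h1, h2⟩, ⟨h1, h3⟩⟩
  obtain ⟨t, ht0, htR, ht⟩ : ∃ t, 0 < t ∧ t < R ∧ R * cos δ < t * cos ((α - β) / 2) := by
    have h1 : ∀ᶠ t in nhdsWithin R (Iio R), R * cos δ < t * cos ((α - β) / 2) := by
      refine Filter.Eventually.filter_mono nhdsWithin_le_nhds ?_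
      have : ContinuousAt (fun t => t * cos ((α - β) / 2)) R := by fun_prop
      exact this.eventually_const_lt (mul_lt_mul_of_pos_left hcos hR)
    have h2 : ∀ᶠ t in nhdsWithin R (Iio R), 0 < t :=
      Filter.Eventually.filter_mono nhdsWithin_le_nhds (lt_mem_nhds hR)
    obtain ⟨t, ⟨ha, hb⟩, hc⟩ := ((h1.and h2).and self_mem_nhdsWithin).exists
    exact ⟨t, hb, hc, ha⟩
  have hne : U.Nonempty := by
    refine ⟨t • unitVec ((α + β) / 2), ?_, ?_, ?_⟩
    · simpa [norm_smul, abs_of_pos ht0] using htR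
    · change _ < inner ℝ _ _
      rw [real_inner_smul_right, inner_unitVec]
      convert ht using 3
      ring
    · change _ < inner ℝ _ _
      rw [real_inner_smul_right, inner_unitVec, ← cos_neg (β - _)]
      convert ht using 3
      ring
  exact (hU.measure_pos volume hne).ne' (measure_mono_null hUsub h)

end Caps

section RegularPolygon

theorem isCompact_regularPolygon (m : ℕ) (c₀ : EuclideanSpace ℝ (Fin 2)) (R φ : ℝ) :
    IsCompact (regularPolygon m c₀ R φ) :=
  (finite_range _).isCompact_convexHull ℝ

/-- The rotation of the Euclidean plane by the angle `δ`. -/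
noncomputable def planeRotation (δ : ℝ) :
    EuclideanSpace ℝ (Fin 2) ≃ₗᵢ[ℝ] EuclideanSpace ℝ (Fin 2) :=
  Complex.orthonormalBasisOneI.repr.symm.trans
    ((rotation (Circle.exp δ)).trans Complex.orthonormalBasisOneI.repr)

theorem planeRotation_unitVec (δ θ : ℝ) :
    planeRotation δ (unitVec θ) = unitVec (θ + δ) := by
  have h : Complex.orthonormalBasisOneI.repr.symm (unitVec θ) = Complex.exp (θ * Complex.I) := by
    rw [Complex.exp_mul_I]
    simp [unitVec, Complex.orthonormalBasisOneI]
  have h2 : Complex.exp (δ * Complex.I) * Complex.exp (θ * Complex.I) =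
      Complex.exp ((θ + δ : ℝ) * Complex.I) := by
    rw [← Complex.exp_add]; congr 1; push_cast; ring
  simp only [planeRotation, LinearIsometryEquiv.trans_apply, rotation_apply, Circle.coe_exp, h, h2]
  ext i
  fin_cases i
  · simpa using Complex.exp_ofReal_mul_I_re (θ + δ)
  · simpa using Complex.exp_ofReal_mul_I_im (θ + δ)

theorem image_convexHull_range_add_const {ι : Type*} (v : ι → EuclideanSpace ℝ (Fin 2))
    (c : EuclideanSpace ℝ (Fin 2)) :
    (fun x => x + c) '' convexHull ℝ (range v) = convexHull ℝ (range fun i => v i + c) := by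
  have := (AffineEquiv.constVAdd ℝ (EuclideanSpace ℝ (Fin 2)) c).toAffineMap.image_convexHull
    (range v)
  rw [← range_comp] at this
  simpa [Function.comp_def, add_comm] using this

theorem exists_isometryEquiv_image_regularPolygon (m : ℕ) (c c' : EuclideanSpace ℝ (Fin 2))
    (R φ ψ : ℝ) : ∃ f : EuclideanSpace ℝ (Fin 2) ≃ᵢ EuclideanSpace ℝ (Fin 2),
      f '' regularPolygon m c R φ = regularPolygon m c' R ψ := by
  let f := ((IsometryEquiv.addRight (-c)).trans (planeRotation (ψ - φ)).toIsometryEquiv).trans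
    (IsometryEquiv.addRight c')
  refine ⟨f, ?_⟩
  have hf : ⇑f = (fun x => x + c') ∘ (planeRotation (ψ - φ)) ∘ fun x => x + -c := rfl
  rw [hf, image_comp, image_comp, regularPolygon_eq, image_convexHull_range_add_const]
  have := (planeRotation (ψ - φ)).toLinearEquiv.toLinearMap.image_convexHull
    (range fun i : Fin m => c + R • unitVec (2 * π * i.1 / m + φ) + -c)
  rw [← range_comp] at this
  have h2 := congrArg (fun s => (fun x => x + c') '' s) this
  simp only [image_convexHull_range_add_const] at h2
  rw [regularPolygon_eq]
  refine Eq.trans h2 ?_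
  congr 2
  ext1 k
  simp only [Function.comp_apply, add_neg_cancel_comm]
  change planeRotation (ψ - φ) (R • _) + c' = _
  rw [map_smul, planeRotation_unitVec, add_comm]
  congr 3
  ring

theorem IsometryEquiv.volume_image (f : EuclideanSpace ℝ (Fin 2) ≃ᵢ EuclideanSpace ℝ (Fin 2))
    (s : Set (EuclideanSpace ℝ (Fin 2))) : volume (f '' s) = volume s := by
  rw [← EuclideanSpace.euclideanHausdorffMeasure_eq_volume 2]
  exact f.isometry.euclideanHausdorffMeasure_image s

theorem volume_regularPolygon_eq (m : ℕ) (c c' : EuclideanSpace ℝ (Fin 2))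
    (R φ ψ : ℝ) : volume (regularPolygon m c R φ) = volume (regularPolygon m c' R ψ) := by
  obtain ⟨f, hf⟩ := exists_isometryEquiv_image_regularPolygon m c c' R φ ψ
  rw [← hf, f.volume_image]

theorem inner_le_of_mem_regularPolygon {m : ℕ} (hm : 3 ≤ m) {R φ : ℝ} (hR : 0 < R)
    {x : EuclideanSpace ℝ (Fin 2)} (hx : x ∈ regularPolygon m 0 R φ) (n : ℤ) :
    inner ℝ (unitVec (φ + (2 * n + 1) * π / m)) x ≤ R * cos (π / m) := by
  rw [regularPolygon_eq] at hx
  refine inner_le_of_mem_convexHull ?_ hx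
  rintro _ ⟨k, rfl⟩
  simp only [zero_add]
  rw [real_inner_smul_right, inner_unitVec]
  refine mul_le_mul_of_nonneg_left ?_ hR.le
  have h : φ + (2 * n + 1) * π / m - (2 * π * k.1 / m + φ) =
      (2 * ((n - k.1 : ℤ) : ℝ) + 1) * π / m := by
    push_cast
    ring
  rw [h]
  exact cos_odd_mul_pi_div_le m hm _

theorem regularPolygon_subset_closedBall {m : ℕ} {R φ : ℝ} (hR : 0 < R) :
    regularPolygon m 0 R φ ⊆ closedBall 0 R := by
  rw [regularPolygon_eq]
  refine convexHull_min ?_ (convex_closedBall 0 R)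
  rintro _ ⟨k, rfl⟩
  simp [norm_smul, abs_of_pos hR]

theorem cos_pi_div_pos {m : ℕ} (hm : 3 ≤ m) : 0 < cos (π / m) := by
  have hp := pi_pos
  have h3 : (3 : ℝ) ≤ m := by exact_mod_cast hm
  apply cos_pos_of_mem_Ioo
  constructor
  · have : 0 < π / m := by positivity
    linarith
  · rw [div_lt_div_iff₀ (by positivity) (by norm_num)]
    nlinarith

theorem disjoint_discCap {m : ℕ} (hm : 3 ≤ m) {R φ : ℝ} {k l : Fin m}
    (hkl : k ≠ l) : Disjoint (discCap (R * cos (π / m)) R (φ + (2 * (k.1 : ℤ) + 1) * π / m))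
      (discCap (R * cos (π / m)) R (φ + (2 * (l.1 : ℤ) + 1) * π / m)) := by
  have hm0 : (0 : ℝ) < m := by positivity
  have hp := pi_pos
  rw [Set.disjoint_left]
  rintro x ⟨hxR, h1⟩ ⟨-, h2⟩
  obtain ⟨θ, hθ⟩ := exists_eq_norm_smul_unitVec x
  rw [mem_closedBall_zero_iff] at hxR
  have hc := cos_pi_div_pos hm
  have aux : ∀ η : ℝ, R * cos (π / m) < inner ℝ (unitVec η) x →
      ∃ q : ℤ, |η - θ - q * (2 * π)| < π / m := by
    intro η h
    rw [hθ, real_inner_smul_right, inner_unitVec] at h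
    refine exists_int_abs_sub_lt_of_cos_lt (by positivity)
      (div_le_self hp.le (by exact_mod_cast (by omega : 1 ≤ m))) ?_
    by_contra! h3
    nlinarith [norm_nonneg x, mul_le_mul_of_nonneg_left h3 (norm_nonneg x)]
  obtain ⟨p, hp1⟩ := aux _ h1
  obtain ⟨q, hq1⟩ := aux _ h2
  have h3 : |((k.1 - l.1 - m * (p - q) : ℤ) : ℝ) * (2 * (π / m))| < 2 * (π / m) := by
    rw [abs_lt] at *
    have : ((k.1 - l.1 - m * (p - q) : ℤ) : ℝ) * (2 * (π / m)) =
      (φ + (2 * (k.1 : ℤ) + 1) * π / m - θ - p * (2 * π)) -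
      (φ + (2 * (l.1 : ℤ) + 1) * π / m - θ - q * (2 * π)) := by
      push_cast; field_simp; ring
    rw [this]
    constructor <;> linarith [hp1.1, hp1.2, hq1.1, hq1.2]
  rw [abs_mul, abs_of_pos (by positivity : 0 < 2 * (π / m)), mul_lt_iff_lt_one_left (by positivity),
    ← Int.cast_abs] at h3
  have h4 : |(k.1 - l.1 - m * (p - q) : ℤ)| < 1 := by exact_mod_cast h3
  rw [Int.abs_lt_one_iff] at h4
  have h5 : (k.1 : ℤ) ≡ l.1 [ZMOD m] := by
    rw [Int.modEq_comm, Int.modEq_iff_dvd]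
    exact ⟨p - q, by linarith⟩
  rw [Int.natCast_modEq_iff] at h5
  exact hkl (Fin.ext (h5.eq_of_lt_of_lt k.2 l.2))

theorem volume_regularPolygon_add_le {m : ℕ} (hm : 3 ≤ m) {R : ℝ} (hR : 0 < R)
    (c : EuclideanSpace ℝ (Fin 2)) (φ : ℝ) :
    volume (regularPolygon m c R φ) + m * volume (discCap (R * cos (π / m)) R 0) ≤
      volume (closedBall (0 : EuclideanSpace ℝ (Fin 2)) R) := by
  rw [volume_regularPolygon_eq m c 0 R φ φ]
  let s : Fin m → Set (EuclideanSpace ℝ (Fin 2)) := fun k =>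
    discCap (R * cos (π / m)) R (φ + (2 * (k.1 : ℤ) + 1) * π / m)
  have h1 : volume (⋃ k, s k) = m * volume (discCap (R * cos (π / m)) R 0) := by
    rw [measure_iUnion (fun k l hkl => disjoint_discCap hm hkl)
      fun k => measurableSet_discCap _ _ _]
    simp [volume_discCap _ _ (_ + _)]
  have h2 : Disjoint (regularPolygon m 0 R φ) (⋃ k, s k) := by
    rw [Set.disjoint_left]
    intro x hx hxs
    obtain ⟨k, hk⟩ := mem_iUnion.1 hxs
    exact (inner_le_of_mem_regularPolygon hm hR hx k.1).not_gt hk.2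
  rw [← h1, ← measure_union h2 (MeasurableSet.iUnion fun k => measurableSet_discCap _ _ _)]
  exact measure_mono (union_subset (regularPolygon_subset_closedBall hR)
    (iUnion_subset fun k => discCap_subset_closedBall _ _ _))

theorem closedBall_subset_regularPolygon {m : ℕ} (hm : 3 ≤ m) {R : ℝ} (hR : 0 < R)
    (φ : ℝ) : closedBall 0 (R * cos (π / m)) ⊆ regularPolygon m 0 R φ := by
  have hm0 : (0 : ℝ) < m := by positivity
  have hp := pi_pos
  have hc := cos_pi_div_pos hm
  intro x hx
  rw [mem_closedBall_zero_iff] at hx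
  by_contra hcon
  obtain ⟨f, s, hf, hs⟩ := geometric_hahn_banach_closed_point (convex_convexHull ℝ _)
    (isCompact_regularPolygon m 0 R φ).isClosed hcon
  let w := (InnerProductSpace.toDual ℝ (EuclideanSpace ℝ (Fin 2))).symm f
  have hw : ∀ y, inner ℝ w y = f y := fun y => InnerProductSpace.toDual_symm_apply
  obtain ⟨θ, hθ⟩ := exists_eq_norm_smul_unitVec w
  let n : ℤ := round ((θ - φ) * m / (2 * π))
  have hmz : (0 : ℤ) < m := by omega
  let k : Fin m := ⟨(n % m).toNat, by have := Int.emod_lt_of_pos n hmz; omega⟩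
  have hk : ((k.1 : ℤ) : ℝ) = n - m * (n / m : ℤ) := by
    have : (k.1 : ℤ) = n - m * (n / m) := by
      rw [← Int.emod_def]
      exact Int.toNat_of_nonneg (Int.emod_nonneg n hmz.ne')
    rw [this]; push_cast; ring
  have hcos : cos (π / m) ≤ cos (θ - (2 * π * k.1 / m + φ)) := by
    have h1 : θ - (2 * π * k.1 / m + φ) =
        ((θ - φ) * m / (2 * π) - n) * (2 * (π / m)) + (n / m : ℤ) * (2 * π) := by
      rw [← Int.cast_natCast, hk]
      field_simp
      ring
    rw [h1, cos_add_int_mul_two_pi, ← cos_abs (_ * _)]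
    refine cos_le_cos_of_nonneg_of_le_pi (abs_nonneg _)
      (div_le_self hp.le (by exact_mod_cast (by omega : 1 ≤ m))) ?_
    rw [abs_mul, abs_of_pos (by positivity : 0 < 2 * (π / m))]
    have h2 : |(θ - φ) * m / (2 * π) - n| ≤ 1 / 2 := abs_sub_round _
    nlinarith [div_pos hp hm0]
  have hvk : 0 + R • unitVec (2 * π * k.1 / m + φ) ∈ regularPolygon m 0 R φ :=
    subset_convexHull ℝ _ ⟨k, rfl⟩
  have h1 := hf _ hvk
  rw [← hw] at h1 hs
  rw [zero_add, hθ, real_inner_smul_left, real_inner_smul_right, inner_unitVec] at h1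
  have h2 := real_inner_le_norm w x
  have h3 := mul_le_mul_of_nonneg_left hx (norm_nonneg w)
  have h4 := mul_le_mul_of_nonneg_left (mul_le_mul_of_nonneg_left hcos hR.le) (norm_nonneg w)
  linarith

end RegularPolygon

section ChebyshevRadius

theorem bddAbove_setOf_closedBall_subset {S : Set (EuclideanSpace ℝ (Fin 2))}
    (hS : Bornology.IsBounded S) : BddAbove {r : ℝ | 0 ≤ r ∧ ∃ c, closedBall c r ⊆ S} := by
  refine ⟨diam S, ?_⟩
  rintro r ⟨hr, c, hc⟩
  have := dist_le_diam_of_mem hS (hc (mem_closedBall_self hr))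
    (hc (show c + r • unitVec 0 ∈ closedBall c r by simp [norm_smul, abs_of_nonneg hr]))
  simpa [norm_smul, abs_of_nonneg hr] using this

theorem le_chebyshevRadius {S : Set (EuclideanSpace ℝ (Fin 2))} (hS : Bornology.IsBounded S)
    {r : ℝ} (hr : 0 ≤ r) {c : EuclideanSpace ℝ (Fin 2)} (h : closedBall c r ⊆ S) :
    r ≤ chebyshevRadius S :=
  le_csSup (bddAbove_setOf_closedBall_subset hS) ⟨hr, c, h⟩

theorem exists_closedBall_subset_of_le_chebyshevRadius {S : Set (EuclideanSpace ℝ (Fin 2))}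
    (hS : IsCompact S) (hne : S.Nonempty) {r : ℝ} (hr : 0 < r) (h : r ≤ chebyshevRadius S) :
    ∃ c, closedBall c r ⊆ S := by
  obtain ⟨c, -, hmax⟩ := hS.exists_isMaxOn hne (continuous_infDist_pt Sᶜ).continuousOn
  have hle : chebyshevRadius S ≤ infDist c Sᶜ := by
    refine Real.sSup_le ?_ infDist_nonneg
    rintro r' ⟨hr', c', hc'⟩
    refine le_trans ?_ (hmax (hc' (mem_closedBall_self hr')))
    have hcne : Sᶜ.Nonempty := nonempty_compl.2 hS.ne_univ
    refine (le_infDist hcne).2 fun y hy => ?_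
    by_contra! hlt
    exact hy (hc' (by rw [mem_closedBall, dist_comm]; exact hlt.le))
  refine ⟨c, ?_⟩
  rw [← closure_ball c hr.ne']
  exact closure_minimal ((ball_subset_ball (h.trans hle)).trans ball_infDist_compl_subset)
    hS.isClosed

end ChebyshevRadius

section Extremal

theorem Convex.eq_of_subset_of_volume_le {S T : Set (EuclideanSpace ℝ (Fin 2))} (hT : Convex ℝ T)
    (hTc : IsCompact T) (hTi : (interior T).Nonempty) (hS : IsClosed S) (hST : S ⊆ T)
    (hvol : volume T ≤ volume S) : S = T := by
  refine hST.antisymm ?_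
  have h1 : volume (T \ S) = 0 := by
    rw [measure_sdiff hST hS.measurableSet.nullMeasurableSet
      (measure_ne_top_of_subset hST hTc.measure_lt_top.ne)]
    exact tsub_eq_zero_of_le hvol
  have h2 : interior T \ S = ∅ := by
    by_contra hne
    exact ((isOpen_interior.sdiff hS).measure_pos volume (nonempty_iff_ne_empty.2 hne)).ne'
      (measure_mono_null (sdiff_subset_sdiff_left interior_subset) h1)
  calc T ⊆ closure T := subset_closure
    _ = closure (interior T) := (hT.closure_interior_eq_closure_of_nonempty_interior hTi).symm
    _ ⊆ S := closure_minimal (sdiff_eq_empty.1 h2) hS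

/-- A convex hull of `m` points containing the incircle of a regular `m`-gon, and with at most the
area of that `m`-gon, is itself a regular `m`-gon with the same circumradius. -/
theorem exists_eq_regularPolygon_of_closedBall_subset {m : ℕ} (hm : 3 ≤ m) {R φ : ℝ} (hR : 0 < R)
    {c₀ : EuclideanSpace ℝ (Fin 2)} {v : Fin m → EuclideanSpace ℝ (Fin 2)}
    (hball : closedBall 0 (R * cos (π / m)) ⊆ convexHull ℝ (range v))
    (harea : volume (convexHull ℝ (range v)) ≤ volume (regularPolygon m c₀ R φ)) :
    ∃ ψ, convexHull ℝ (range v) = regularPolygon m 0 R ψ := by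
  have hm0 : (0 : ℝ) < m := by positivity
  have hp := pi_pos
  have hr : 0 < R * cos (π / m) := mul_pos hR (cos_pi_div_pos hm)
  obtain ⟨α, hα⟩ := exists_normals hr hball
  set P := convexHull ℝ (range v)
  have hPc : IsCompact P := (finite_range v).isCompact_convexHull ℝ
  let s : Fin m → Set (EuclideanSpace ℝ (Fin 2)) := fun i => discCap (R * cos (π / m)) R (α i)
  have hcover : closedBall 0 R ⊆ P ∪ ⋃ i, s i := by
    intro x hx
    by_cases h : ∀ i, inner ℝ (unitVec (α i)) x ≤ R * cos (π / m)
    · exact Or.inl (hα x h)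
    · push Not at h
      obtain ⟨i, hi⟩ := h
      exact Or.inr (mem_iUnion.2 ⟨i, hx, hi⟩)
  have hsum : ∑ i, volume (s i) = m * volume (discCap (R * cos (π / m)) R 0) := by
    simp [s, volume_discCap _ _ (α _)]
  have hle : ∑ i, volume (s i) ≤ volume (⋃ i, s i) := by
    have hfin : volume (regularPolygon m c₀ R φ) ≠ ⊤ :=
      (isCompact_regularPolygon m c₀ R φ).measure_lt_top.ne
    rw [hsum]
    refine (ENNReal.add_le_add_iff_left hfin).1 ?_
    exact (volume_regularPolygon_add_le hm hR c₀ φ).trans <| (measure_mono hcover).trans <|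
      (measure_union_le _ _).trans <| add_le_add_left harea _
  have hgap : ∀ i j, i ≠ j → ∀ n : ℤ, 2 * (π / m) ≤ |α i - α j + n * (2 * π)| := by
    intro i j hij n
    have h := measure_inter_eq_zero_of_sum_le_measure_iUnion
      (fun i => measurableSet_discCap _ _ _) (fun i => volume_discCap_ne_top _ _ _) hle hij
    have hshift : discCap (R * cos (π / m)) R (α i) =
        discCap (R * cos (π / m)) R (α i + n * (2 * π)) := by
      simp only [discCap, unitVec_add_int_mul_two_pi]
    rw [hshift] at h
    convert two_mul_le_abs_sub_of_volume_inter_discCap hR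
      (div_le_self hp.le (by exact_mod_cast (by omega : 1 ≤ m))) h using 2
    ring
  let i₀ : Fin m := ⟨0, by omega⟩
  have hint : ∀ i, ∃ n : ℤ, α i = α i₀ + n * (2 * (π / m)) := by
    intro i
    obtain ⟨n, hn⟩ := exists_int_of_one_le_abs_sub (by omega : 2 ≤ m)
      (fun i => (α i - α i₀) / (2 * (π / m))) i₀ (by simp) (fun i j hij n => by
        have h1 : (α i - α i₀) / (2 * (π / m)) - (α j - α i₀) / (2 * (π / m)) + m * n =
            (α i - α j + n * (2 * π)) / (2 * (π / m)) := by
          field_simp; ring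
        rw [h1, abs_div, abs_of_pos (by positivity : 0 < 2 * (π / m)), le_div_iff₀ (by positivity),
          one_mul]
        exact hgap i j hij n) i
    refine ⟨n, ?_⟩
    rw [div_eq_iff (by positivity)] at hn
    linarith
  refine ⟨α i₀ - π / m, Eq.symm ?_⟩
  refine (convex_convexHull ℝ _).eq_of_subset_of_volume_le hPc ?_
    (isCompact_regularPolygon _ _ _ _).isClosed ?_
    (harea.trans (volume_regularPolygon_eq m c₀ 0 R φ _).le)
  · exact ⟨0, interior_mono hball (by
      rw [interior_closedBall _ hr.ne']; exact mem_ball_self hr)⟩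
  · intro x hx
    refine hα x fun i => ?_
    obtain ⟨n, hn⟩ := hint i
    convert inner_le_of_mem_regularPolygon hm hR hx n using 3
    rw [hn]
    ring

end Extremal

/-- (Lemma 1) Among convex hulls of `m` points with the same positive area as a regular `m`-gon
`P₁`, any polygon `P₂` that is not congruent to `P₁` (not the image of `P₁` under an isometry of
the plane) has strictly smaller Chebyshev radius than `P₁`. -/
theorem chebyshevRadius_lt_of_not_congruent_regular (m : ℕ) (hm : 3 ≤ m)
    (c₀ : EuclideanSpace ℝ (Fin 2)) (R φ : ℝ) (hR : 0 < R)
    (v : Fin m → EuclideanSpace ℝ (Fin 2))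
    (harea : volume (convexHull ℝ (Set.range v)) = volume (regularPolygon m c₀ R φ))
    (hpos : 0 < volume (convexHull ℝ (Set.range v)))
    (hiso : ¬ ∃ f : EuclideanSpace ℝ (Fin 2) ≃ᵢ EuclideanSpace ℝ (Fin 2),
        f '' regularPolygon m c₀ R φ = convexHull ℝ (Set.range v)) :
    chebyshevRadius (convexHull ℝ (Set.range v)) < chebyshevRadius (regularPolygon m c₀ R φ) := by
  by_contra! hle
  refine hiso ?_
  have hr : 0 < R * Real.cos (Real.pi / m) := mul_pos hR (cos_pi_div_pos hm)
  have hPc : IsCompact (convexHull ℝ (Set.range v)) :=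
    (Set.finite_range v).isCompact_convexHull ℝ
  have hrad : R * Real.cos (Real.pi / m) ≤ chebyshevRadius (convexHull ℝ (Set.range v)) := by
    obtain ⟨f, hf⟩ := exists_isometryEquiv_image_regularPolygon m 0 c₀ R φ φ
    refine le_trans (le_chebyshevRadius (isCompact_regularPolygon m c₀ R φ).isBounded hr.le
      (c := f 0) ?_) hle
    rw [← hf, ← f.image_closedBall]
    exact Set.image_mono (closedBall_subset_regularPolygon hm hR φ)
  obtain ⟨c, hc⟩ := exists_closedBall_subset_of_le_chebyshevRadius hPc
    (nonempty_of_measure_ne_zero hpos.ne') hr hrad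
  let g : EuclideanSpace ℝ (Fin 2) ≃ᵢ EuclideanSpace ℝ (Fin 2) := IsometryEquiv.addRight (-c)
  have hg : g '' convexHull ℝ (Set.range v) = convexHull ℝ (Set.range fun i => v i + -c) :=
    image_convexHull_range_add_const v (-c)
  have hball : closedBall 0 (R * Real.cos (Real.pi / m)) ⊆
      convexHull ℝ (Set.range fun i => v i + -c) := by
    have h0 : g c = 0 := add_neg_cancel c
    rw [← hg, ← h0, ← g.image_closedBall]
    exact Set.image_mono hc
  obtain ⟨ψ, hψ⟩ := exists_eq_regularPolygon_of_closedBall_subset hm hR hball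
    (by rw [← hg, g.volume_image, harea])
  obtain ⟨f, hf⟩ := exists_isometryEquiv_image_regularPolygon m c₀ 0 R φ ψ
  refine ⟨f.trans g.symm, ?_⟩
  change (g.symm ∘ f) '' _ = _
  rw [Set.image_comp, hf, ← hψ, ← hg, ← Set.image_comp]
  simp
end
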